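/- arXiv:1909.04115 — 6 statements merged into one kernel-verified Lean document; each statement's English description precedes it below -/
import Mathlib

section
/- Let p and p̂ be two Markov kernels from S × A to S. Then the ℓ^q distance between the policy gradient and the model-value-based gradient satisfies ‖∇J − ∇^MVG J‖_q ≤ (γ·√2·Z·R_max/(1−γ)²) · √( ∫ KL(p(·|s,a) ‖ p̂(·|s,a)) dη_μ^{π,p}(s,a) ). -/
open MeasureTheory ProbabilityTheory
open scoped ENNReal

noncomputable section

variable {S A : Type*} [MeasurableSpace S] [MeasurableSpace A]

/-- The step kernel `K^{π,p}` on `S × A`: from `(s,a)`, draw `s' ~ p(·|s,a)` and then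
`a' ~ π(·|s')`. -/
def stepK (p : Kernel (S × A) S) (π : Kernel S A) : Kernel (S × A) (S × A) :=
  p ⊗ₖ Kernel.prodMkLeft (S × A) π

/-- `δ_t[m₀]`: the law of the time-`t` state–action pair of the Markov chain with initial
distribution `m₀` and transition kernel `K^{π,p}`. -/
def stepIter (p : Kernel (S × A) S) (π : Kernel S A) (m₀ : Measure (S × A)) :
    ℕ → Measure (S × A)
  | 0 => m₀
  | t + 1 => (stepIter p π m₀ t).bind (fun x => stepK p π x)

/-- The `γ`-discounted state–action distribution `δ^{π,p}[m₀] = (1-γ) ∑ₜ γ^t δ_t[m₀]`. -/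
def disc (p : Kernel (S × A) S) (π : Kernel S A) (γ : ℝ) (m₀ : Measure (S × A)) :
    Measure (S × A) :=
  Measure.sum fun t => ENNReal.ofReal ((1 - γ) * γ ^ t) • stepIter p π m₀ t

/-- The (normalized) action-value function `Q^{π,p}(s,a) = ∫ r dδ_{s,a}^{π,p}`. -/
def Qval (p : Kernel (S × A) S) (π : Kernel S A) (γ : ℝ) (r : S × A → ℝ)
    (sa : S × A) : ℝ :=
  ∫ x, r x ∂(disc p π γ (Measure.dirac sa))

/-- The ℓ^q norm on ℝ^d. -/
def lqNorm (q : ℝ≥0∞) [Fact (1 ≤ q)] {d : ℕ} (v : Fin d → ℝ) : ℝ :=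
  ‖(WithLp.equiv q (Fin d → ℝ)).symm v‖

open Classical in
/-- Kullback–Leibler divergence `KL(P‖Q) = ∫ log (dP/dQ) dP`, with value `∞` when
`P` is not absolutely continuous w.r.t. `Q` or the log-likelihood ratio is not integrable. -/
def klDiv' {X : Type*} [MeasurableSpace X] (P Q : Measure X) : ℝ≥0∞ :=
  if P ≪ Q ∧ Integrable (fun x => Real.log (P.rnDeriv Q x).toReal) P then
    ENNReal.ofReal (∫ x, Real.log (P.rnDeriv Q x).toReal ∂P)
  else ⊤

theorem mul_le_klFun_add_exp_sub_one {x : ℝ} (hx : 0 ≤ x) (a : ℝ) :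
    x * a ≤ InformationTheory.klFun x + Real.exp a - 1 := by
  rw [InformationTheory.klFun_apply]
  rcases hx.eq_or_lt with rfl | hx
  · simp [(Real.exp_pos a).le]
  · have h := mul_le_mul_of_nonneg_left (Real.add_one_le_exp (a - Real.log x)) hx.le
    rw [Real.exp_sub, Real.exp_log hx, mul_div_cancel₀ _ hx.ne'] at h
    linarith

section Pinsker

variable {X : Type*} [MeasurableSpace X] {P Q : Measure X} [IsProbabilityMeasure P]
  [IsProbabilityMeasure Q]

/-- One half of the Donsker–Varadhan variational principle, for bounded functions. -/
theorem integral_le_integral_llr_of_integral_exp_le_one (hPQ : P ≪ Q)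
    (hfint : Integrable (llr P Q) P) {f : X → ℝ} (hf : Measurable f) {C : ℝ}
    (hC : ∀ x, |f x| ≤ C) (hexp : ∫ x, Real.exp (f x) ∂Q ≤ 1) :
    ∫ x, f x ∂P ≤ ∫ x, llr P Q x ∂P := by
  have hfP : Integrable f P := .of_bound hf.aestronglyMeasurable C (ae_of_all _ hC)
  have hkl := (InformationTheory.integrable_klFun_rnDeriv_iff hPQ).2 hfint
  have hexpQ : Integrable (fun x => Real.exp (f x)) Q :=
    .of_bound (Real.measurable_exp.comp hf).aestronglyMeasurable (Real.exp C) <|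
      ae_of_all _ fun x => by
        rw [Real.norm_eq_abs, Real.abs_exp]
        exact Real.exp_le_exp.2 ((le_abs_self _).trans (hC x))
  have hmul : Integrable (fun x => (P.rnDeriv Q x).toReal * f x) Q :=
    (integrable_toReal_rnDeriv_mul_iff hPQ).2 hfP
  have h := integral_mono hmul ((hkl.add hexpQ).sub (integrable_const 1))
    fun x => mul_le_klFun_add_exp_sub_one ENNReal.toReal_nonneg (f x)
  rw [integral_toReal_rnDeriv_mul hPQ] at h
  rw [integral_sub' (hkl.add hexpQ) (integrable_const 1),
    integral_add' hkl hexpQ, InformationTheory.integral_klFun_rnDeriv hPQ hfint] at h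
  simp only [probReal_univ, integral_const, smul_eq_mul, mul_one] at h
  linarith

/-- Pinsker's inequality, in its form for integrals of bounded functions. -/
theorem sq_integral_sub_integral_le_integral_llr (hPQ : P ≪ Q)
    (hfint : Integrable (llr P Q) P) {V : X → ℝ} (hV : Measurable V) {R : ℝ}
    (hR : ∀ x, |V x| ≤ R) :
    (∫ x, V x ∂P - ∫ x, V x ∂Q) ^ 2 ≤ 2 * R ^ 2 * ∫ x, llr P Q x ∂P := by
  obtain ⟨x₀⟩ : Nonempty X := nonempty_of_isProbabilityMeasure P
  have hR0 : 0 ≤ R := (abs_nonneg _).trans (hR x₀)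
  rcases hR0.eq_or_lt with rfl | hRpos
  · have : V = fun _ => 0 := funext fun x => abs_nonpos_iff.1 (hR x)
    simp [this]
  set m := ∫ x, V x ∂Q
  set D := ∫ x, V x ∂P - m with hD
  have hVP : Integrable V P := .of_bound hV.aestronglyMeasurable R (ae_of_all _ hR)
  have hsub := hasSubgaussianMGF_of_mem_Icc (μ := Q) hV.aemeasurable
    (ae_of_all _ fun x => abs_le.1 (hR x))
  have key (t : ℝ) : t * D - t ^ 2 * R ^ 2 / 2 ≤ ∫ x, llr P Q x ∂P := by
    have hmgf := hsub.mgf_le t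
    have hc : ((((‖R - -R‖₊ / 2) ^ 2 : NNReal) : ℝ)) = R ^ 2 := by
      simp only [NNReal.coe_pow, NNReal.coe_div, coe_nnnorm, Real.norm_eq_abs, NNReal.coe_ofNat]
      rw [div_pow, sq_abs]; ring
    rw [hc, mgf] at hmgf
    have h := integral_le_integral_llr_of_integral_exp_le_one hPQ hfint
      (f := fun x => t * (V x - m) - t ^ 2 * R ^ 2 / 2)
      (((hV.sub_const m).const_mul t).sub_const _)
      (C := |t| * (R + |m|) + |t ^ 2 * R ^ 2 / 2|)
      (fun x => (abs_sub _ _).trans <| by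
        rw [abs_mul]
        gcongr
        exact (abs_sub _ _).trans (add_le_add_left (hR x) _)) ?_
    · have hVm : Integrable (fun x => t * (V x - m)) P :=
        (hVP.sub (integrable_const m)).const_mul t
      rwa [integral_sub hVm (integrable_const _),
        integral_const_mul, integral_sub hVP (integrable_const m), integral_const, integral_const,
        probReal_univ, one_smul, one_smul] at h
    · simp_rw [Real.exp_sub _ (t ^ 2 * R ^ 2 / 2)]
      rw [integral_div, div_le_one (Real.exp_pos _)]
      rwa [mul_comm (t ^ 2)]
  have h := key (D / R ^ 2)
  have h2 : D / R ^ 2 * D - (D / R ^ 2) ^ 2 * R ^ 2 / 2 = D ^ 2 / (2 * R ^ 2) := by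
    field_simp
    ring
  rw [h2, div_le_iff₀ (by positivity)] at h
  linarith

theorem ofReal_sq_integral_sub_integral_le_klDiv' {V : X → ℝ} (hV : Measurable V) {R : ℝ}
    (hR : ∀ x, |V x| ≤ R) :
    ENNReal.ofReal ((∫ x, V x ∂P - ∫ x, V x ∂Q) ^ 2) ≤
      ENNReal.ofReal (2 * R ^ 2) * klDiv' P Q := by
  unfold klDiv'
  split_ifs with h
  · rw [← ENNReal.ofReal_mul (by positivity)]
    exact ENNReal.ofReal_le_ofReal (sq_integral_sub_integral_le_integral_llr h.1 h.2 hV hR)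
  obtain ⟨x₀⟩ : Nonempty X := nonempty_of_isProbabilityMeasure P
  rcases ((abs_nonneg _).trans (hR x₀)).eq_or_lt with rfl | hRpos
  · have : V = fun _ => 0 := funext fun x => abs_nonpos_iff.1 (hR x)
    simp [this]
  · rw [ENNReal.mul_top (by simpa using hRpos.ne')]
    exact le_top

end Pinsker

section Discounted

variable (p : Kernel (S × A) S) (π : Kernel S A)

instance [IsMarkovKernel p] [IsMarkovKernel π] : IsMarkovKernel (stepK p π) := by
  unfold stepK; infer_instance

theorem stepIter_bind_stepK (m : Measure (S × A)) (t : ℕ) :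
    stepIter p π (m.bind fun x => stepK p π x) t = stepIter p π m (t + 1) := by
  induction t with
  | zero => rfl
  | succ t ih => rw [stepIter, ih]; rfl

theorem measurable_stepIter (t : ℕ) : Measurable fun m => stepIter p π m t := by
  induction t with
  | zero => exact measurable_id
  | succ t ih => exact (Measure.measurable_bind' (stepK p π).measurable).comp ih

theorem bind_stepIter {X : Type*} [MeasurableSpace X] (m : Measure X)
    {κ : X → Measure (S × A)} (hκ : Measurable κ) (t : ℕ) :
    m.bind (fun x => stepIter p π (κ x) t) = stepIter p π (m.bind κ) t := by
  induction t with
  | zero => rfl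
  | succ t ih =>
    have hmeas : Measurable fun x => stepIter p π (κ x) t := (measurable_stepIter p π t).comp hκ
    rw [stepIter, ← ih, Measure.bind_bind hmeas.aemeasurable
      (stepK p π).measurable.aemeasurable]
    rfl

instance isProbabilityMeasure_stepIter [IsMarkovKernel p] [IsMarkovKernel π]
    (m : Measure (S × A)) [IsProbabilityMeasure m] (t : ℕ) :
    IsProbabilityMeasure (stepIter p π m t) := by
  induction t with
  | zero => assumption
  | succ t ih =>
    exact inferInstanceAs (IsProbabilityMeasure ((stepIter p π m t).bind (stepK p π)))

variable (γ : ℝ)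

theorem measurable_disc : Measurable (disc p π γ) := by
  refine Measure.measurable_of_measurable_coe _ fun s hs => ?_
  simp only [disc, Measure.sum_apply _ hs, Measure.smul_apply, smul_eq_mul]
  exact Measurable.tsum fun t =>
    ((Measure.measurable_coe hs).comp (measurable_stepIter p π t)).const_mul _

theorem bind_disc {X : Type*} [MeasurableSpace X] (m : Measure X)
    {κ : X → Measure (S × A)} (hκ : Measurable κ) :
    m.bind (fun x => disc p π γ (κ x)) = disc p π γ (m.bind κ) := by
  ext s hs
  have hdisc : Measurable fun x => disc p π γ (κ x) := (measurable_disc p π γ).comp hκ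
  have hiter (t : ℕ) : Measurable fun x => stepIter p π (κ x) t :=
    (measurable_stepIter p π t).comp hκ
  rw [Measure.bind_apply hs hdisc.aemeasurable]
  simp only [disc, Measure.sum_apply _ hs, Measure.smul_apply, smul_eq_mul]
  have hmeas (t : ℕ) : Measurable fun x => stepIter p π (κ x) t s :=
    (Measure.measurable_coe hs).comp (hiter t)
  rw [lintegral_tsum fun t => ((hmeas t).const_mul _).aemeasurable]
  refine tsum_congr fun t => ?_
  rw [lintegral_const_mul _ (hmeas t), ← bind_stepIter p π m hκ,
    Measure.bind_apply hs (hiter t).aemeasurable]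

theorem disc_bind_stepK (m : Measure (S × A)) :
    disc p π γ (m.bind fun x => stepK p π x) = (disc p π γ m).bind fun x => stepK p π x := by
  rw [disc, disc, Measure.bind_sum _ _ (stepK p π).measurable.aemeasurable]
  simp_rw [Measure.bind_smul, stepIter_bind_stepK]
  rfl

variable {γ}

theorem disc_eq_add (hγ0 : 0 ≤ γ) (m : Measure (S × A)) :
    disc p π γ m = ENNReal.ofReal (1 - γ) • m +
      ENNReal.ofReal γ • disc p π γ (m.bind fun x => stepK p π x) := by
  ext s hs
  simp only [disc, Measure.sum_apply _ hs, Measure.smul_apply, smul_eq_mul, Measure.add_apply]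
  rw [tsum_eq_zero_add' (f := fun t => ENNReal.ofReal ((1 - γ) * γ ^ t) * stepIter p π m t s)
    ENNReal.summable, ← ENNReal.tsum_mul_left, pow_zero, mul_one]
  refine congrArg₂ (· + ·) rfl (tsum_congr fun t => ?_)
  rw [stepIter_bind_stepK, ← mul_assoc, ← ENNReal.ofReal_mul hγ0, pow_succ']
  congr 2
  ring

theorem isProbabilityMeasure_disc [IsMarkovKernel p] [IsMarkovKernel π] (hγ0 : 0 ≤ γ)
    (hγ1 : γ < 1) (m : Measure (S × A)) [IsProbabilityMeasure m] :
    IsProbabilityMeasure (disc p π γ m) := by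
  refine ⟨?_⟩
  simp only [disc, Measure.sum_apply _ .univ, Measure.smul_apply, measure_univ, smul_eq_mul,
    mul_one]
  rw [← ENNReal.ofReal_tsum_of_nonneg
    (fun t => mul_nonneg (sub_nonneg.2 hγ1.le) (pow_nonneg hγ0 t))
    ((summable_geometric_of_lt_one hγ0 hγ1).mul_left _), tsum_mul_left,
    tsum_geometric_of_lt_one hγ0 hγ1, mul_inv_cancel₀ (sub_pos.2 hγ1).ne', ENNReal.ofReal_one]

/-- The kernel `(s, a) ↦ δ_{s,a}^{π,p}`. -/
def discKernel (p : Kernel (S × A) S) (π : Kernel S A) (γ : ℝ) : Kernel (S × A) (S × A) where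
  toFun x := disc p π γ (Measure.dirac x)
  measurable' := (measurable_disc p π γ).comp Measure.measurable_dirac

theorem isMarkovKernel_discKernel [IsMarkovKernel p] [IsMarkovKernel π] (hγ0 : 0 ≤ γ)
    (hγ1 : γ < 1) : IsMarkovKernel (discKernel p π γ) :=
  ⟨fun _ => isProbabilityMeasure_disc p π hγ0 hγ1 _⟩

theorem disc_eq_bind_discKernel (m : Measure (S × A)) :
    disc p π γ m = m.bind (discKernel p π γ) := by
  conv_lhs => rw [← Measure.bind_dirac (m := m)]
  exact (bind_disc p π γ m Measure.measurable_dirac).symm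

theorem measurable_Qval {r : S × A → ℝ} (hr : Measurable r) : Measurable (Qval p π γ r) :=
  (StronglyMeasurable.integral_kernel (κ := discKernel p π γ) hr.stronglyMeasurable).measurable

/-- The one-step model error `∫ Q^{π,p̂} d(K^{π,p} - K^{π,p̂})`. -/
def modelErr (p phat : Kernel (S × A) S) (π : Kernel S A) (γ : ℝ) (r : S × A → ℝ)
    (x : S × A) : ℝ :=
  ∫ y, Qval phat π γ r y ∂(stepK p π x) - ∫ y, Qval phat π γ r y ∂(stepK phat π x)

theorem measurable_modelErr (phat : Kernel (S × A) S) {r : S × A → ℝ} (hr : Measurable r) :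
    Measurable (modelErr p phat π γ r) :=
  (StronglyMeasurable.integral_kernel
      (measurable_Qval phat π hr).stronglyMeasurable).measurable.sub
    (StronglyMeasurable.integral_kernel
      (measurable_Qval phat π hr).stronglyMeasurable).measurable

end Discounted

theorem abs_integral_le_of_forall_abs_le {X : Type*} [MeasurableSpace X] (m : Measure X)
    [IsProbabilityMeasure m] {f : X → ℝ} {C : ℝ} (hC : ∀ x, |f x| ≤ C) :
    |∫ x, f x ∂m| ≤ C := by
  simpa using norm_integral_le_of_norm_le_const (μ := m) (f := f) (C := C) (ae_of_all _ hC)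

theorem integral_bind_kernel {X Y : Type*} [MeasurableSpace X] [MeasurableSpace Y]
    (m : Measure X) [IsProbabilityMeasure m] (κ : Kernel X Y) [IsMarkovKernel κ] {f : Y → ℝ}
    (hf : Measurable f) {C : ℝ} (hC : ∀ y, |f y| ≤ C) :
    ∫ y, f y ∂(m.bind κ) = ∫ x, ∫ y, f y ∂κ x ∂m :=
  Kernel.integral_comp (κ := Kernel.const Unit m) (η := κ) (a := ())
    (.of_bound hf.aestronglyMeasurable C (ae_of_all _ hC))

section Value

variable (p phat : Kernel (S × A) S) [IsMarkovKernel p] [IsMarkovKernel phat]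
  (π : Kernel S A) [IsMarkovKernel π] {γ : ℝ} {r : S × A → ℝ} {R : ℝ}

theorem abs_Qval_le (hγ0 : 0 ≤ γ) (hγ1 : γ < 1) (hR : ∀ x, |r x| ≤ R) (x : S × A) :
    |Qval p π γ r x| ≤ R :=
  have := isProbabilityMeasure_disc p π hγ0 hγ1 (Measure.dirac x)
  abs_integral_le_of_forall_abs_le _ hR

theorem integral_disc_eq_add (hγ0 : 0 ≤ γ) (hγ1 : γ < 1) (m : Measure (S × A))
    [IsProbabilityMeasure m] {f : S × A → ℝ} (hf : Measurable f) (hR : ∀ x, |f x| ≤ R) :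
    ∫ x, f x ∂(disc p π γ m) =
      (1 - γ) * ∫ x, f x ∂m + γ * ∫ x, f x ∂(disc p π γ (m.bind fun x => stepK p π x)) := by
  have : IsProbabilityMeasure (m.bind fun x => stepK p π x) :=
    inferInstanceAs (IsProbabilityMeasure (m.bind (stepK p π)))
  have := isProbabilityMeasure_disc p π hγ0 hγ1 (m.bind fun x => stepK p π x)
  have hfint (m : Measure (S × A)) [IsProbabilityMeasure m] : Integrable f m :=
    .of_bound hf.aestronglyMeasurable R (ae_of_all _ hR)
  rw [disc_eq_add p π hγ0 m, integral_add_measure ((hfint _).smul_measure (by simp))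
    ((hfint _).smul_measure (by simp)), integral_smul_measure, integral_smul_measure,
    ENNReal.toReal_ofReal hγ0, ENNReal.toReal_ofReal (sub_nonneg.2 hγ1.le)]
  rfl

/-- The Bellman equation. -/
theorem Qval_eq (hγ0 : 0 ≤ γ) (hγ1 : γ < 1) (hr : Measurable r) (hR : ∀ x, |r x| ≤ R)
    (x : S × A) :
    Qval p π γ r x = (1 - γ) * r x + γ * ∫ y, Qval p π γ r y ∂(stepK p π x) := by
  have := isMarkovKernel_discKernel p π hγ0 hγ1
  rw [Qval, integral_disc_eq_add p π hγ0 hγ1 _ hr hR,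
    Measure.dirac_bind (stepK p π).measurable, integral_dirac' _ _ hr.stronglyMeasurable,
    disc_eq_bind_discKernel, integral_bind_kernel _ _ hr hR]
  rfl

theorem Qval_sub_Qval (hγ0 : 0 ≤ γ) (hγ1 : γ < 1) (hr : Measurable r) (hR : ∀ x, |r x| ≤ R)
    (x : S × A) :
    Qval p π γ r x - Qval phat π γ r x =
      γ / (1 - γ) * ∫ y, modelErr p phat π γ r y ∂(disc p π γ (Measure.dirac x)) := by
  have hprob := isProbabilityMeasure_disc p π hγ0 hγ1 (Measure.dirac x)
  have hQm : Measurable (Qval phat π γ r) := measurable_Qval phat π hr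
  have hQb := abs_Qval_le phat π hγ0 hγ1 hR
  have hfint {f : S × A → ℝ} (hf : Measurable f) (hb : ∀ x, |f x| ≤ R) :
      Integrable f (disc p π γ (Measure.dirac x)) :=
    .of_bound hf.aestronglyMeasurable R (ae_of_all _ hb)
  have hK (p' : Kernel (S × A) S) [IsMarkovKernel p'] :
      Integrable (fun y => ∫ z, Qval phat π γ r z ∂(stepK p' π y))
        (disc p π γ (Measure.dirac x)) :=
    hfint (StronglyMeasurable.integral_kernel hQm.stronglyMeasurable).measurable
      fun y => abs_integral_le_of_forall_abs_le _ hQb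
  have hfwd := integral_disc_eq_add p π hγ0 hγ1 (Measure.dirac x) hQm hQb
  rw [disc_bind_stepK, integral_dirac' _ _ hQm.stronglyMeasurable,
    integral_bind_kernel _ (stepK p π) hQm hQb] at hfwd
  have hbell : ∫ y, Qval phat π γ r y ∂(disc p π γ (Measure.dirac x)) =
      (1 - γ) * Qval p π γ r x +
        γ * ∫ y, ∫ z, Qval phat π γ r z ∂(stepK phat π y) ∂(disc p π γ (Measure.dirac x)) := by
    rw [Qval, ← integral_const_mul, ← integral_const_mul,
      ← integral_add ((hfint hr hR).const_mul _) ((hK phat).const_mul _)]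
    exact integral_congr_ae (ae_of_all _ fun y => Qval_eq phat π hγ0 hγ1 hr hR y)
  have herr : ∫ y, modelErr p phat π γ r y ∂(disc p π γ (Measure.dirac x)) = _ :=
    integral_sub (hK p) (hK phat)
  have h1 : 1 - γ ≠ 0 := (sub_pos.2 hγ1).ne'
  rw [herr]
  field_simp
  linarith

theorem ofReal_sq_modelErr_le (hγ0 : 0 ≤ γ) (hγ1 : γ < 1) (hr : Measurable r)
    (hR : ∀ x, |r x| ≤ R) (x : S × A) :
    ENNReal.ofReal (modelErr p phat π γ r x ^ 2) ≤
      ENNReal.ofReal (2 * R ^ 2) * klDiv' (p x) (phat x) := by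
  have hQm : Measurable (Qval phat π γ r) := measurable_Qval phat π hr
  have hQb := abs_Qval_le phat π hγ0 hγ1 hR
  have hK (p' : Kernel (S × A) S) [IsMarkovKernel p'] :
      ∫ y, Qval phat π γ r y ∂(stepK p' π x) =
        ∫ s, ∫ a, Qval phat π γ r (s, a) ∂(π s) ∂(p' x) := by
    rw [stepK, ProbabilityTheory.integral_compProd]
    · rfl
    · exact .of_bound hQm.aestronglyMeasurable R (ae_of_all _ hQb)
  rw [modelErr, hK, hK]
  exact ofReal_sq_integral_sub_integral_le_klDiv'
    (hQm.stronglyMeasurable.integral_kernel_prod_right' (κ := π)).measurable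
    (fun s => abs_integral_le_of_forall_abs_le _ fun a => hQb (s, a))

end Value

theorem lintegral_le_rpow_lintegral_sq {X : Type*} [MeasurableSpace X] (m : Measure X)
    (hm : m Set.univ ≤ 1) {f : X → ℝ≥0∞} (hf : Measurable f) :
    ∫⁻ x, f x ∂m ≤ (∫⁻ x, f x ^ 2 ∂m) ^ ((1 : ℝ) / 2) := by
  have h := ENNReal.lintegral_mul_le_Lp_mul_Lq m Real.HolderConjugate.two_two hf.aemeasurable
    (aemeasurable_const (b := 1))
  simp only [Pi.mul_apply, mul_one, ENNReal.rpow_ofNat, one_pow, lintegral_one] at h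
  refine h.trans (mul_le_of_le_one_right' ?_)
  exact ENNReal.rpow_le_one hm (by norm_num)

section LqNorm

variable {X : Type*} [MeasurableSpace X] {m : Measure X} (q : ℝ≥0∞) [Fact (1 ≤ q)] {d : ℕ}

theorem continuous_lqNorm : Continuous (lqNorm q : (Fin d → ℝ) → ℝ) :=
  (PiLp.continuousLinearEquiv q ℝ fun _ : Fin d => ℝ).symm.continuous.norm

theorem lqNorm_nonneg (v : Fin d → ℝ) : 0 ≤ lqNorm q v := norm_nonneg _

theorem lqNorm_smul (c : ℝ) (v : Fin d → ℝ) : lqNorm q (c • v) = |c| * lqNorm q v :=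
  norm_smul c ((WithLp.equiv q (Fin d → ℝ)).symm v)

theorem integrable_of_integrable_lqNorm {g : X → Fin d → ℝ} (hg : Measurable g)
    (hfint : Integrable (fun x => lqNorm q (g x)) m) : Integrable g m := by
  let L := (PiLp.continuousLinearEquiv q ℝ fun _ : Fin d => ℝ).symm
  have h : Integrable (fun x => L (g x)) m :=
    (integrable_norm_iff (L.continuous.comp_aestronglyMeasurable hg.aestronglyMeasurable)).1 hfint
  exact (L.integrable_comp_iff).1 h

theorem ofReal_lqNorm_integral_le (f : X → Fin d → ℝ) :
    ENNReal.ofReal (lqNorm q (∫ x, f x ∂m)) ≤ ∫⁻ x, ENNReal.ofReal (lqNorm q (f x)) ∂m := by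
  let L := (PiLp.continuousLinearEquiv q ℝ fun _ : Fin d => ℝ).symm
  have h := enorm_integral_le_lintegral_enorm (μ := m) fun x => L (f x)
  rw [L.integral_comp_comm] at h
  simp only [← ofReal_norm] at h
  exact h

end LqNorm

/-- Theorem 1 (bias of the model-value-based gradient): for Markov kernels `p`, `p̂`,
`‖∇J − ∇^MVG J‖_q ≤ (γ √2 Z R_max/(1-γ)²) √(E_{η_μ^{π,p}}[KL(p(·|s,a) ‖ p̂(·|s,a))])`. -/
theorem mvg_bias_bound
    (p phat : Kernel (S × A) S) [IsMarkovKernel p] [IsMarkovKernel phat]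
    (π : Kernel S A) [IsMarkovKernel π]
    (μ : Measure S) [IsProbabilityMeasure μ]
    (γ : ℝ) (hγ0 : 0 ≤ γ) (hγ1 : γ < 1)
    (r : S × A → ℝ) (hr : Measurable r) (Rmax : ℝ) (hRmax : ∀ x, |r x| ≤ Rmax)
    (d : ℕ) (hd : 1 ≤ d) (q : ℝ≥0∞) [Fact (1 ≤ q)]
    (g : S × A → Fin d → ℝ) (hg : Measurable g)
    (Z : ℝ) (hZ : Z = ∫ x, lqNorm q (g x) ∂(disc p π γ (μ ⊗ₘ π)))
    (hZint : Integrable (fun x => lqNorm q (g x)) (disc p π γ (μ ⊗ₘ π)))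
    (hZpos : 0 < Z) :
    ENNReal.ofReal (lqNorm q
        (((1 - γ)⁻¹ • ∫ x, Qval p π γ r x • g x ∂(disc p π γ (μ ⊗ₘ π))) -
         ((1 - γ)⁻¹ • ∫ x, Qval phat π γ r x • g x ∂(disc p π γ (μ ⊗ₘ π))))) ≤
      ENNReal.ofReal (γ * Real.sqrt 2 * Z * Rmax / (1 - γ) ^ 2) *
        (∫⁻ x, klDiv' (p x) (phat x)
            ∂(Measure.bind
                ((disc p π γ (μ ⊗ₘ π)).withDensity
                  (fun x => ENNReal.ofReal (lqNorm q (g x) / Z)))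
                (fun sa => disc p π γ (Measure.dirac sa)))) ^ ((1 : ℝ) / 2) := by
  have hγ : 0 < 1 - γ := sub_pos.2 hγ1
  have hm := isProbabilityMeasure_disc p π hγ0 hγ1 (μ ⊗ₘ π)
  have hdK := isMarkovKernel_discKernel p π hγ0 hγ1
  set m := disc p π γ (μ ⊗ₘ π)
  obtain ⟨x₀⟩ : Nonempty (S × A) := nonempty_of_isProbabilityMeasure m
  have hR0 : 0 ≤ Rmax := (abs_nonneg _).trans (hRmax x₀)
  have hgm : Measurable fun x => lqNorm q (g x) := (continuous_lqNorm q).measurable.comp hg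
  set ρ : S × A → ℝ≥0∞ := fun x => ENNReal.ofReal (lqNorm q (g x) / Z) with hρ
  have hρm : Measurable ρ := (hgm.div_const Z).ennreal_ofReal
  set η := (m.withDensity ρ).bind fun sa => disc p π γ (Measure.dirac sa) with hη
  have hdm : Measurable fun sa => disc p π γ (Measure.dirac sa) := (discKernel p π γ).measurable
  have hη1 : η Set.univ ≤ 1 := by
    rw [hη, Measure.bind_apply .univ hdm.aemeasurable]
    have hone (x : S × A) : disc p π γ (Measure.dirac x) Set.univ = 1 := (hdK.1 x).measure_univ
    simp only [hone, lintegral_one, withDensity_apply _ .univ, Measure.restrict_univ]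
    rw [hρ, ← ofReal_integral_eq_lintegral_ofReal (hZint.div_const Z)
      (ae_of_all _ fun x => div_nonneg (lqNorm_nonneg q _) hZpos.le), integral_div, ← hZ,
      div_self hZpos.ne', ENNReal.ofReal_one]
  set e := modelErr p phat π γ r
  have hem : Measurable fun x => ENNReal.ofReal |e x| :=
    (measurable_modelErr p π phat hr).abs.ennreal_ofReal
  have hem' : Measurable fun x => ∫⁻ y, ENNReal.ofReal |e y| ∂(disc p π γ (Measure.dirac x)) :=
    (Measure.measurable_lintegral hem).comp hdm
  have hgint := integrable_of_integrable_lqNorm q hg hZint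
  have hfint (p' : Kernel (S × A) S) [IsMarkovKernel p'] :
      Integrable (fun x => Qval p' π γ r x • g x) m :=
    hgint.bdd_smul (φ := Qval p' π γ r) Rmax
      (measurable_Qval p' π hr).aestronglyMeasurable
      (ae_of_all _ fun x => abs_Qval_le p' π hγ0 hγ1 hRmax x)
  have hdiff (x : S × A) : ENNReal.ofReal |Qval p π γ r x - Qval phat π γ r x| ≤
      ENNReal.ofReal (γ / (1 - γ)) *
        ∫⁻ y, ENNReal.ofReal |e y| ∂(disc p π γ (Measure.dirac x)) := by
    rw [Qval_sub_Qval p phat π hγ0 hγ1 hr hRmax, abs_mul, abs_of_nonneg (by positivity),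
      ENNReal.ofReal_mul (by positivity)]
    gcongr
    simpa only [← Real.norm_eq_abs, ofReal_norm] using
      enorm_integral_le_lintegral_enorm _
  have hsq : ∫⁻ x, ENNReal.ofReal |e x| ^ 2 ∂η ≤
      ENNReal.ofReal (2 * Rmax ^ 2) * ∫⁻ x, klDiv' (p x) (phat x) ∂η := by
    rw [← lintegral_const_mul' _ _ ENNReal.ofReal_ne_top]
    refine lintegral_mono fun x => ?_
    rw [← ENNReal.ofReal_pow (abs_nonneg _), sq_abs]
    exact ofReal_sq_modelErr_le p phat π hγ0 hγ1 hr hRmax x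
  calc _ ≤ ENNReal.ofReal (1 - γ)⁻¹ * ∫⁻ x,
        ENNReal.ofReal |Qval p π γ r x - Qval phat π γ r x| *
          ENNReal.ofReal (lqNorm q (g x)) ∂m := by
        rw [← smul_sub, ← integral_sub (hfint p) (hfint phat), lqNorm_smul,
          abs_of_pos (inv_pos.2 hγ), ENNReal.ofReal_mul (inv_pos.2 hγ).le]
        gcongr
        refine (ofReal_lqNorm_integral_le q _).trans_eq (lintegral_congr fun x => ?_)
        rw [← sub_smul, lqNorm_smul, ENNReal.ofReal_mul (abs_nonneg _)]
    _ ≤ ENNReal.ofReal (1 - γ)⁻¹ * ∫⁻ x, ENNReal.ofReal (γ / (1 - γ) * Z) *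
        (ρ x * ∫⁻ y, ENNReal.ofReal |e y| ∂(disc p π γ (Measure.dirac x))) ∂m := by
        refine mul_le_mul_right (lintegral_mono fun x => ?_) _
        have hgρ : ENNReal.ofReal (lqNorm q (g x)) = ENNReal.ofReal Z * ρ x := by
          rw [hρ, ← ENNReal.ofReal_mul hZpos.le, mul_div_cancel₀ _ hZpos.ne']
        rw [hgρ, ENNReal.ofReal_mul (by positivity)]
        calc _ ≤ _ := mul_le_mul_left (hdiff x) _
          _ = _ := by ring
    _ = ENNReal.ofReal (γ * Z / (1 - γ) ^ 2) * ∫⁻ x, ENNReal.ofReal |e x| ∂η := by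
        rw [lintegral_const_mul' _ _ ENNReal.ofReal_ne_top, hη,
          Measure.lintegral_bind hdm.aemeasurable hem.aemeasurable,
          lintegral_withDensity_eq_lintegral_mul _ hρm hem',
          ← mul_assoc, ← ENNReal.ofReal_mul (inv_pos.2 hγ).le]
        congr 2
        field_simp
    _ ≤ ENNReal.ofReal (γ * Z / (1 - γ) ^ 2) *
        (ENNReal.ofReal (2 * Rmax ^ 2) * ∫⁻ x, klDiv' (p x) (phat x) ∂η) ^ ((1 : ℝ) / 2) := by
        gcongr
        exact (lintegral_le_rpow_lintegral_sq η hη1 hem).trans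
          (ENNReal.rpow_le_rpow hsq (by norm_num))
    _ = _ := by
        rw [ENNReal.mul_rpow_of_nonneg _ _ (by norm_num),
          ENNReal.ofReal_rpow_of_nonneg (by positivity) (by norm_num), ← Real.sqrt_eq_rpow,
          Real.sqrt_mul (by norm_num), Real.sqrt_sq hR0, ← mul_assoc,
          ← ENNReal.ofReal_mul (by positivity)]
        congr 2
        ring

end
end

section
/- For any finite measures m and m′ on S and any Markov kernel π from S to A, the measures obtained by attaching actions via π satisfy ‖m ⋉ π − m′ ⋉ π‖_TV = ‖m − m′‖_TV. -/
open MeasureTheory ProbabilityTheory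
open scoped ENNReal

noncomputable section

/-- The total-variation norm `‖m − m'‖_TV` of the difference of two (finite) measures.
For finite measures this supremum equals `|m − m'|(univ)`, i.e. the total variation of
the signed measure `m − m'`. -/
def tvDist {X : Type*} [MeasurableSpace X] (m m' : Measure X) : ℝ≥0∞ :=
  ⨆ (B : Set X) (_ : MeasurableSet B), ((m B - m' B) + (m' Bᶜ - m Bᶜ))

namespace MeasureTheory.Measure

variable {X : Type*} [MeasurableSpace X] {μ ν : Measure X}

lemma sub_apply_univ_of_isHahnDecomposition [IsFiniteMeasure μ] [IsFiniteMeasure ν]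
    {s : Set X} (hs : IsHahnDecomposition ν μ s) : (μ - ν) Set.univ = μ s - ν s := by
  rw [← measure_add_measure_compl hs.measurableSet,
    sub_apply_eq_zero_of_isHahnDecomposition hs.compl, add_zero, ← restrict_apply_univ s,
    restrict_sub_eq_restrict_sub_restrict hs.measurableSet, sub_apply .univ hs.le_on,
    restrict_apply_univ, restrict_apply_univ]

lemma compProd_mono_left {Y : Type*} [MeasurableSpace Y] [SFinite μ] [SFinite ν]
    (κ : Kernel X Y) [IsSFiniteKernel κ] (h : μ ≤ ν) : μ ⊗ₘ κ ≤ ν ⊗ₘ κ := by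
  refine Measure.le_iff.2 fun s hs ↦ ?_
  rw [compProd_apply hs, compProd_apply hs]
  exact lintegral_mono' h le_rfl

end MeasureTheory.Measure

lemma tvDist_le_of_le_add {X : Type*} [MeasurableSpace X] {m m' p q : Measure X}
    (hp : m ≤ p + m') (hq : m' ≤ q + m) : tvDist m m' ≤ p Set.univ + q Set.univ := by
  refine iSup₂_le fun B _ ↦ add_le_add ?_ ?_
  · exact (tsub_le_iff_right.2 (hp B)).trans (measure_mono (Set.subset_univ B))
  · exact (tsub_le_iff_right.2 (hq Bᶜ)).trans (measure_mono (Set.subset_univ Bᶜ))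

lemma sub_univ_add_sub_univ_le_tvDist {X : Type*} [MeasurableSpace X] (m m' : Measure X)
    [IsFiniteMeasure m] [IsFiniteMeasure m'] :
    (m - m') Set.univ + (m' - m) Set.univ ≤ tvDist m m' := by
  obtain ⟨s, hs⟩ := exists_isHahnDecomposition m' m
  rw [Measure.sub_apply_univ_of_isHahnDecomposition hs,
    Measure.sub_apply_univ_of_isHahnDecomposition hs.compl]
  exact le_iSup₂_of_le s hs.measurableSet le_rfl

lemma tvDist_map_le {X Y : Type*} [MeasurableSpace X] [MeasurableSpace Y] (m m' : Measure X)
    {f : X → Y} (hf : Measurable f) : tvDist (m.map f) (m'.map f) ≤ tvDist m m' := by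
  refine iSup₂_le fun B hB ↦ ?_
  simp only [Measure.map_apply hf hB, Measure.map_apply hf hB.compl, Set.preimage_compl]
  exact le_iSup₂_of_le (f ⁻¹' B) (hf hB) le_rfl

lemma compProd_le_sub_compProd_add {S A : Type*} [MeasurableSpace S] [MeasurableSpace A]
    (π : Kernel S A) [IsSFiniteKernel π] (m m' : Measure S)
    [IsFiniteMeasure m] [IsFiniteMeasure m'] :
    m ⊗ₘ π ≤ (m - m') ⊗ₘ π + m' ⊗ₘ π := by
  rw [← Measure.compProd_add_left]
  exact Measure.compProd_mono_left π (Measure.sub_le_iff_le_add.1 le_rfl)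

/-- Attaching actions through a Markov kernel `π` preserves the total-variation distance:
`‖m ⋉ π − m' ⋉ π‖_TV = ‖m − m'‖_TV`. -/
theorem tv_compProd_policy
    {S A : Type*} [MeasurableSpace S] [MeasurableSpace A]
    (π : Kernel S A) [IsMarkovKernel π]
    (m m' : Measure S) [IsFiniteMeasure m] [IsFiniteMeasure m'] :
    tvDist (m ⊗ₘ π) (m' ⊗ₘ π) = tvDist m m' := by
  apply le_antisymm
  · refine (tvDist_le_of_le_add (compProd_le_sub_compProd_add π m m')
      (compProd_le_sub_compProd_add π m' m)).trans ?_
    simpa only [Measure.compProd_apply_univ] using sub_univ_add_sub_univ_le_tvDist m m'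
  · have h := tvDist_map_le (m ⊗ₘ π) (m' ⊗ₘ π) measurable_fst
    rwa [← Measure.fst, ← Measure.fst, Measure.fst_compProd, Measure.fst_compProd] at h

end
end

section
/- For any two Markov kernels p and p̂ from S × A to S and every state–action pair (s,a), the action-value functions satisfy |Q^{π,p}(s,a) − Q^{π,p̂}(s,a)| ≤ R_max · ‖δ_{s,a}^{π,p} − δ_{s,a}^{π,p̂}‖_TV ≤ (γ·R_max/(1−γ)) · ∫ ‖p(·|s′,a′) − p̂(·|s′,a′)‖_TV dδ_{s,a}^{π,p}(s′,a′). -/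
open MeasureTheory ProbabilityTheory
open scoped ENNReal

noncomputable section

variable {S A : Type*} [MeasurableSpace S] [MeasurableSpace A]

section Aux

/-- On probability measures, each set `B` contributes `2 (m B - m' B)⁺` to `tvDist`. -/
lemma tvDist_term_eq {X : Type*} [MeasurableSpace X] (m m' : Measure X)
    [IsProbabilityMeasure m] [IsProbabilityMeasure m'] {B : Set X} (hB : MeasurableSet B) :
    (m B - m' B) + (m' Bᶜ - m Bᶜ) = 2 * (m B - m' B) := by
  rw [prob_compl_eq_one_sub hB, prob_compl_eq_one_sub hB,
    ENNReal.sub_sub_sub_cancel_left ENNReal.one_ne_top prob_le_one, two_mul]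

lemma measure_le_add_half_tvDist {X : Type*} [MeasurableSpace X] (m m' : Measure X)
    [IsProbabilityMeasure m] [IsProbabilityMeasure m'] {B : Set X} (hB : MeasurableSet B) :
    m B ≤ m' B + 2⁻¹ * tvDist m m' := by
  have h : 2 * (m B - m' B) ≤ tvDist m m' := by
    rw [← tvDist_term_eq m m' hB]
    exact le_iSup₂ (f := fun (B : Set X) (_ : MeasurableSet B) =>
      (m B - m' B) + (m' Bᶜ - m Bᶜ)) B hB
  rw [← tsub_le_iff_left]
  calc m B - m' B = 2⁻¹ * (2 * (m B - m' B)) := by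
        rw [← mul_assoc, ENNReal.inv_mul_cancel two_ne_zero ENNReal.ofNat_ne_top, one_mul]
    _ ≤ _ := by gcongr

lemma lintegral_ofReal_le_add_tvDist {X : Type*} [MeasurableSpace X] (m m' : Measure X)
    [IsProbabilityMeasure m] [IsProbabilityMeasure m'] {u : X → ℝ} (hu : Measurable u)
    (hu0 : ∀ x, 0 ≤ u x) {M : ℝ} (huM : ∀ x, u x ≤ M) :
    ∫⁻ x, ENNReal.ofReal (u x) ∂m ≤
      ∫⁻ x, ENNReal.ofReal (u x) ∂m' + ENNReal.ofReal M * (2⁻¹ * tvDist m m') := by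
  rw [lintegral_eq_lintegral_meas_le m (.of_forall hu0) hu.aemeasurable,
    lintegral_eq_lintegral_meas_le m' (.of_forall hu0) hu.aemeasurable]
  set c := 2⁻¹ * tvDist m m'
  have hmeas : Measurable ((Set.Iic M).indicator fun _ : ℝ => c) :=
    measurable_const.indicator measurableSet_Iic
  calc ∫⁻ t in Set.Ioi (0 : ℝ), m {x | t ≤ u x}
      ≤ ∫⁻ t in Set.Ioi (0 : ℝ), (m' {x | t ≤ u x} + (Set.Iic M).indicator (fun _ => c) t) := by
        refine lintegral_mono fun t => ?_
        by_cases ht : t ≤ M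
        · simpa [Set.indicator, ht] using
            measure_le_add_half_tvDist m m' (measurableSet_le measurable_const hu)
        · have : {x | t ≤ u x} = ∅ := by
            ext x
            simpa using (huM x).trans_lt (not_le.mp ht)
          simp [this]
    _ = _ := by
        rw [lintegral_add_right _ hmeas, lintegral_indicator measurableSet_Iic,
          setLIntegral_const, Measure.restrict_apply measurableSet_Iic, Set.inter_comm,
          Set.Ioi_inter_Iic, Real.volume_Ioc, sub_zero, mul_comm]

lemma lintegral_le_add_tvDist {X : Type*} [MeasurableSpace X] (m m' : Measure X)
    [IsProbabilityMeasure m] [IsProbabilityMeasure m'] {u : X → ℝ≥0∞} (hu : Measurable u)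
    (hu1 : ∀ x, u x ≤ 1) :
    ∫⁻ x, u x ∂m ≤ ∫⁻ x, u x ∂m' + 2⁻¹ * tvDist m m' := by
  have h := lintegral_ofReal_le_add_tvDist m m' hu.ennreal_toReal
    (fun _ => ENNReal.toReal_nonneg) (M := 1)
    (fun x => ENNReal.toReal_le_of_le_ofReal zero_le_one (by simpa using hu1 x))
  have hcoe (x : X) : ENNReal.ofReal (u x).toReal = u x :=
    ENNReal.ofReal_toReal ((hu1 x).trans_lt ENNReal.one_lt_top).ne
  simpa [hcoe] using h

lemma ofReal_integral_sub_le_tvDist {X : Type*} [MeasurableSpace X] (m m' : Measure X)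
    [IsProbabilityMeasure m] [IsProbabilityMeasure m'] {r : X → ℝ} (hr : Measurable r)
    {R : ℝ} (hR : ∀ x, |r x| ≤ R) :
    ENNReal.ofReal (∫ x, r x ∂m - ∫ x, r x ∂m') ≤ ENNReal.ofReal R * tvDist m m' := by
  have hint (n : Measure X) [IsProbabilityMeasure n] : Integrable r n :=
    .of_bound hr.aestronglyMeasurable R (.of_forall hR)
  have h0 (x : X) : 0 ≤ r x + R := by linarith [(abs_le.mp (hR x)).1]
  have hadd (n : Measure X) [IsProbabilityMeasure n] :
      ∫ x, (r x + R) ∂n = ∫ x, r x ∂n + R := by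
    rw [integral_add (hint n) (integrable_const R)]
    simp
  have hof (n : Measure X) [IsProbabilityMeasure n] :
      ENNReal.ofReal (∫ x, (r x + R) ∂n) = ∫⁻ x, ENNReal.ofReal (r x + R) ∂n :=
    ofReal_integral_eq_lintegral_ofReal ((hint n).add (integrable_const R)) (.of_forall h0)
  have key := lintegral_ofReal_le_add_tvDist m m' (hr.add_const R) h0 (M := 2 * R)
    (fun x => by linarith [(abs_le.mp (hR x)).2])
  have hconst : ENNReal.ofReal (2 * R) * (2⁻¹ * tvDist m m') = ENNReal.ofReal R * tvDist m m' := by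
    rw [ENNReal.ofReal_mul zero_le_two, ENNReal.ofReal_ofNat, mul_comm (2 : ℝ≥0∞),
      mul_assoc, ← mul_assoc 2, ENNReal.mul_inv_cancel two_ne_zero ENNReal.ofNat_ne_top, one_mul]
  rw [hconst, ← hof m, ← hof m', ← tsub_le_iff_left,
    ← ENNReal.ofReal_sub _ (integral_nonneg h0), hadd, hadd] at key
  simpa using key

/-- The action of a kernel on nonnegative functions. -/
def kernelOp {X : Type*} [MeasurableSpace X] (κ : Kernel X X) (g : X → ℝ≥0∞) (x : X) : ℝ≥0∞ :=
  ∫⁻ y, g y ∂(κ x)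

lemma measurable_kernelOp {X : Type*} [MeasurableSpace X] (κ : Kernel X X) {g : X → ℝ≥0∞}
    (hg : Measurable g) : Measurable (kernelOp κ g) :=
  hg.lintegral_kernel

lemma measurable_kernelOp_iterate {X : Type*} [MeasurableSpace X] (κ : Kernel X X)
    {g : X → ℝ≥0∞} (hg : Measurable g) (t : ℕ) : Measurable ((kernelOp κ)^[t] g) := by
  induction t generalizing g with
  | zero => exact hg
  | succ t ih => exact ih (measurable_kernelOp κ hg)

variable (p : Kernel (S × A) S) (π : Kernel S A) (γ : ℝ)

lemma lintegral_stepIter (m₀ : Measure (S × A)) {g : S × A → ℝ≥0∞} (hg : Measurable g) (t : ℕ) :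
    ∫⁻ x, g x ∂(stepIter p π m₀ t) = ∫⁻ x, (kernelOp (stepK p π))^[t] g x ∂m₀ := by
  induction t generalizing g with
  | zero => rfl
  | succ t ih =>
    rw [Function.iterate_succ_apply, ← ih (measurable_kernelOp _ hg), stepIter,
      Measure.lintegral_bind (stepK p π).measurable.aemeasurable hg.aemeasurable]
    rfl

lemma lintegral_disc_dirac {g : S × A → ℝ≥0∞} (hg : Measurable g) (x : S × A) :
    ∫⁻ y, g y ∂(disc p π γ (Measure.dirac x)) =
      ∑' t, ENNReal.ofReal ((1 - γ) * γ ^ t) * (kernelOp (stepK p π))^[t] g x := by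
  rw [disc, lintegral_sum_measure]
  refine tsum_congr fun t => ?_
  rw [lintegral_smul_measure, lintegral_stepIter p π _ hg,
    lintegral_dirac' _ (measurable_kernelOp_iterate _ hg t), smul_eq_mul]

lemma measurable_lintegral_disc_dirac {g : S × A → ℝ≥0∞} (hg : Measurable g) :
    Measurable fun x => ∫⁻ y, g y ∂(disc p π γ (Measure.dirac x)) := by
  simp_rw [lintegral_disc_dirac p π γ hg]
  exact .tsum fun t => (measurable_kernelOp_iterate _ hg t).const_mul _

lemma lintegral_disc_dirac_eq_add (hγ0 : 0 ≤ γ) {g : S × A → ℝ≥0∞} (hg : Measurable g)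
    (x : S × A) :
    ∫⁻ y, g y ∂(disc p π γ (Measure.dirac x)) =
      ENNReal.ofReal (1 - γ) * g x + ENNReal.ofReal γ *
        ∫⁻ y, kernelOp (stepK p π) g y ∂(disc p π γ (Measure.dirac x)) := by
  rw [lintegral_disc_dirac p π γ hg, lintegral_disc_dirac p π γ (measurable_kernelOp _ hg),
    tsum_eq_zero_add' ENNReal.summable, ← ENNReal.tsum_mul_left]
  congr 1
  · simp
  · refine tsum_congr fun t => ?_
    rw [Function.iterate_succ_apply, ← mul_assoc, ← ENNReal.ofReal_mul hγ0]
    congr 2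
    ring

lemma lintegral_disc_dirac_kernelOp {g : S × A → ℝ≥0∞} (hg : Measurable g) (x : S × A) :
    ∫⁻ y, kernelOp (stepK p π) g y ∂(disc p π γ (Measure.dirac x)) =
      kernelOp (stepK p π) (fun z => ∫⁻ y, g y ∂(disc p π γ (Measure.dirac z))) x := by
  simp_rw [lintegral_disc_dirac p π γ hg]
  rw [lintegral_disc_dirac p π γ (measurable_kernelOp _ hg), kernelOp, lintegral_tsum
    fun t => ((measurable_kernelOp_iterate _ hg t).const_mul _).aemeasurable]
  refine tsum_congr fun t => ?_
  rw [lintegral_const_mul _ (measurable_kernelOp_iterate _ hg t), ← Function.iterate_succ_apply,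
    Function.iterate_succ_apply']
  rfl

lemma isProbabilityMeasure_disc_dirac [IsMarkovKernel p] [IsMarkovKernel π]
    (hγ0 : 0 ≤ γ) (hγ1 : γ < 1) (x : S × A) :
    IsProbabilityMeasure (disc p π γ (Measure.dirac x)) := by
  have hK : IsMarkovKernel (stepK p π) := by unfold stepK; infer_instance
  have hfix : Function.IsFixedPt (kernelOp (stepK p π)) 1 := by
    funext x
    simp [kernelOp]
  constructor
  have h := lintegral_disc_dirac p π γ measurable_one x
  simp only [Pi.one_apply, lintegral_one, (hfix.iterate _).eq, mul_one] at h
  rw [h, ← ENNReal.ofReal_tsum_of_nonneg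
    (fun t => mul_nonneg (sub_nonneg.2 hγ1.le) (pow_nonneg hγ0 t))
    ((summable_geometric_of_lt_one hγ0 hγ1).mul_left _), tsum_mul_left,
    tsum_geometric_of_lt_one hγ0 hγ1, mul_inv_cancel₀ (sub_pos.2 hγ1).ne', ENNReal.ofReal_one]

lemma kernelOp_stepK_le_add_tvDist (phat : Kernel (S × A) S) [IsMarkovKernel p]
    [IsMarkovKernel phat] [IsMarkovKernel π] {g : S × A → ℝ≥0∞} (hg : Measurable g)
    (hg1 : ∀ x, g x ≤ 1) (x : S × A) :
    kernelOp (stepK p π) g x ≤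
      kernelOp (stepK phat π) g x + 2⁻¹ * tvDist (p x) (phat x) := by
  simp only [kernelOp, stepK, Kernel.lintegral_compProd _ _ _ hg, Kernel.prodMkLeft_apply]
  refine lintegral_le_add_tvDist _ _ (hg.lintegral_kernel_prod_right' (κ := π)) fun s => ?_
  calc ∫⁻ a, g (s, a) ∂(π s) ≤ ∫⁻ _, 1 ∂(π s) := lintegral_mono fun a => hg1 _
    _ = 1 := by simp

/-- The simulation lemma for a test function `g` with values in `[0, 1]`. -/
lemma lintegral_disc_dirac_le_add_tvDist (phat : Kernel (S × A) S) [IsMarkovKernel p]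
    [IsMarkovKernel phat] [IsMarkovKernel π] (hγ0 : 0 ≤ γ) (hγ1 : γ < 1)
    {g : S × A → ℝ≥0∞} (hg : Measurable g) (hg1 : ∀ x, g x ≤ 1) (x : S × A) :
    ENNReal.ofReal (1 - γ) * ∫⁻ y, g y ∂(disc p π γ (Measure.dirac x)) ≤
      ENNReal.ofReal (1 - γ) * ∫⁻ y, g y ∂(disc phat π γ (Measure.dirac x)) +
        ENNReal.ofReal γ *
          (2⁻¹ * ∫⁻ y, tvDist (p y) (phat y) ∂(disc p π γ (Measure.dirac x))) := by
  have := isProbabilityMeasure_disc_dirac p π γ hγ0 hγ1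
  have := isProbabilityMeasure_disc_dirac phat π γ hγ0 hγ1
  set δ := disc p π γ (Measure.dirac x)
  set V : S × A → ℝ≥0∞ := fun z => ∫⁻ y, g y ∂(disc phat π γ (Measure.dirac z)) with hVdef
  have hV : Measurable V := measurable_lintegral_disc_dirac phat π γ hg
  have hV1 (z : S × A) : V z ≤ 1 := by
    calc V z ≤ ∫⁻ _, 1 ∂(disc phat π γ (Measure.dirac z)) := lintegral_mono hg1
      _ = 1 := by simp
  have hKV := measurable_kernelOp (stepK phat π) hV
  have hKV1 (z : S × A) : kernelOp (stepK phat π) V z ≤ 1 := by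
    have hK : IsMarkovKernel (stepK phat π) := by unfold stepK; infer_instance
    calc kernelOp (stepK phat π) V z ≤ ∫⁻ _, 1 ∂(stepK phat π z) := lintegral_mono hV1
      _ = 1 := by simp
  have hbackward (z : S × A) : V z =
      ENNReal.ofReal (1 - γ) * g z + ENNReal.ofReal γ * kernelOp (stepK phat π) V z := by
    rw [hVdef, ← lintegral_disc_dirac_kernelOp phat π γ hg]
    exact lintegral_disc_dirac_eq_add phat π γ hγ0 hg z
  have hleft : ∫⁻ z, V z ∂δ = ENNReal.ofReal (1 - γ) * ∫⁻ z, g z ∂δ +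
      ENNReal.ofReal γ * ∫⁻ z, kernelOp (stepK phat π) V z ∂δ := by
    rw [← lintegral_const_mul _ hg, ← lintegral_const_mul _ hKV,
      ← lintegral_add_left (hg.const_mul _)]
    exact lintegral_congr hbackward
  have hright := lintegral_disc_dirac_eq_add p π γ hγ0 hV x
  have hdiff : ∫⁻ z, kernelOp (stepK p π) V z ∂δ ≤
      ∫⁻ z, kernelOp (stepK phat π) V z ∂δ + 2⁻¹ * ∫⁻ z, tvDist (p z) (phat z) ∂δ := by
    rw [← lintegral_const_mul' _ _ (by simp), ← lintegral_add_left hKV]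
    exact lintegral_mono (kernelOp_stepK_le_add_tvDist p π phat hV hV1)
  have hfin : ENNReal.ofReal γ * ∫⁻ z, kernelOp (stepK phat π) V z ∂δ ≠ ∞ := by
    refine ENNReal.mul_ne_top ENNReal.ofReal_ne_top (ne_top_of_le_ne_top ENNReal.one_ne_top ?_)
    calc ∫⁻ z, kernelOp (stepK phat π) V z ∂δ ≤ ∫⁻ _, 1 ∂δ := lintegral_mono hKV1
      _ = 1 := by rw [lintegral_one]; exact measure_univ
  refine ENNReal.le_of_add_le_add_right hfin ?_
  rw [← hleft, hright, add_assoc, ← mul_add, add_comm (2⁻¹ * _)]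
  gcongr

lemma tvDist_disc_dirac_le (phat : Kernel (S × A) S) [IsMarkovKernel p]
    [IsMarkovKernel phat] [IsMarkovKernel π] (hγ0 : 0 ≤ γ) (hγ1 : γ < 1) (x : S × A) :
    tvDist (disc p π γ (Measure.dirac x)) (disc phat π γ (Measure.dirac x)) ≤
      ENNReal.ofReal (γ / (1 - γ)) *
        ∫⁻ y, tvDist (p y) (phat y) ∂(disc p π γ (Measure.dirac x)) := by
  have := isProbabilityMeasure_disc_dirac p π γ hγ0 hγ1
  have := isProbabilityMeasure_disc_dirac phat π γ hγ0 hγ1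
  refine iSup₂_le fun B hB => ?_
  rw [tvDist_term_eq _ _ hB]
  have key := lintegral_disc_dirac_le_add_tvDist p π γ phat hγ0 hγ1
    (g := B.indicator 1) (measurable_one.indicator hB)
    (fun y => Set.indicator_le_self' (by simp) y) x
  rw [lintegral_indicator_one hB, lintegral_indicator_one hB, ← tsub_le_iff_left,
    ← ENNReal.mul_sub (by simp)] at key
  have hpos : ENNReal.ofReal (1 - γ) ≠ 0 := by simpa using hγ1
  rw [ENNReal.ofReal_div_of_pos (sub_pos.2 hγ1), ENNReal.div_eq_inv_mul, mul_assoc,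
    ← ENNReal.mul_le_iff_le_inv hpos ENNReal.ofReal_ne_top, mul_left_comm]
  calc _ ≤ 2 * (ENNReal.ofReal γ *
        (2⁻¹ * ∫⁻ y, tvDist (p y) (phat y) ∂(disc p π γ (Measure.dirac x)))) := by gcongr
    _ = _ := by
      rw [mul_left_comm, ← mul_assoc 2,
        ENNReal.mul_inv_cancel two_ne_zero ENNReal.ofNat_ne_top, one_mul]

end Aux

/-- For any two Markov transition kernels `p`, `p̂` and any state–action pair,
`|Q^{π,p}(s,a) − Q^{π,p̂}(s,a)| ≤ R_max ‖δ_{s,a}^{π,p} − δ_{s,a}^{π,p̂}‖_TV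
  ≤ (γ R_max/(1−γ)) ∫ ‖p(·|s',a') − p̂(·|s',a')‖_TV dδ_{s,a}^{π,p}`. -/
theorem qval_diff_bound
    (p phat : Kernel (S × A) S) [IsMarkovKernel p] [IsMarkovKernel phat]
    (π : Kernel S A) [IsMarkovKernel π]
    (γ : ℝ) (hγ0 : 0 ≤ γ) (hγ1 : γ < 1)
    (r : S × A → ℝ) (hr : Measurable r)
    (Rmax : ℝ) (hRmax0 : 0 ≤ Rmax) (hRmax : ∀ x, |r x| ≤ Rmax)
    (sa : S × A) :
    ENNReal.ofReal |Qval p π γ r sa - Qval phat π γ r sa| ≤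
        ENNReal.ofReal Rmax *
          tvDist (disc p π γ (Measure.dirac sa)) (disc phat π γ (Measure.dirac sa)) ∧
      ENNReal.ofReal Rmax *
          tvDist (disc p π γ (Measure.dirac sa)) (disc phat π γ (Measure.dirac sa)) ≤
        ENNReal.ofReal (γ * Rmax / (1 - γ)) *
          ∫⁻ x, tvDist (p x) (phat x) ∂(disc p π γ (Measure.dirac sa)) := by
  have := isProbabilityMeasure_disc_dirac p π γ hγ0 hγ1 sa
  have := isProbabilityMeasure_disc_dirac phat π γ hγ0 hγ1 sa
  constructor
  · have hpos := ofReal_integral_sub_le_tvDist (disc p π γ (Measure.dirac sa))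
      (disc phat π γ (Measure.dirac sa)) hr hRmax
    have hneg := ofReal_integral_sub_le_tvDist (disc p π γ (Measure.dirac sa))
      (disc phat π γ (Measure.dirac sa)) hr.neg (R := Rmax) (by simpa using hRmax)
    simp only [Pi.neg_apply, integral_neg, ← neg_sub', ← Qval.eq_1] at hpos hneg
    rcases abs_choice (Qval p π γ r sa - Qval phat π γ r sa) with h | h <;> rwa [h]
  · refine (mul_le_mul_right (tvDist_disc_dirac_le p π γ phat hγ0 hγ1 sa) _).trans_eq ?_
    rw [← mul_assoc, ← ENNReal.ofReal_mul hRmax0, mul_div_assoc', mul_comm Rmax]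

end
end

section
/- The γ-discounted state–action distribution satisfies the flow (fixed-point) equation δ_μ^{π,p} = (1−γ)·(μ ⋉ π) + γ·(δ_μ^{π,p} ∘ K^{π,p}), where δ ∘ K denotes the image measure B ↦ ∫ K^{π,p}((s,a),B) dδ(s,a). -/
open MeasureTheory ProbabilityTheory
open scoped ENNReal

noncomputable section

variable {S A : Type*} [MeasurableSpace S] [MeasurableSpace A]

/-- Flow (fixed-point) equation for the discounted state–action distribution:
`δ_μ^{π,p} = (1−γ)(μ ⋉ π) + γ (δ_μ^{π,p} ∘ K^{π,p})`. -/
theorem disc_fixed_point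
    (p : Kernel (S × A) S) [IsMarkovKernel p] (π : Kernel S A) [IsMarkovKernel π]
    (μ : Measure S) [IsProbabilityMeasure μ]
    (γ : ℝ) (hγ0 : 0 ≤ γ) (hγ1 : γ < 1) :
    disc p π γ (μ ⊗ₘ π) =
      ENNReal.ofReal (1 - γ) • (μ ⊗ₘ π) +
        ENNReal.ofReal γ • ((disc p π γ (μ ⊗ₘ π)).bind (fun x => stepK p π x)) := by
  simp only [disc]
  ext B hB
  have hK : Measurable (stepK p π : S × A → Measure (S × A)) := (stepK p π).measurable
  simp only [Measure.add_apply, Measure.smul_apply, smul_eq_mul]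
  rw [Measure.sum_apply _ hB, Measure.bind_apply hB hK.aemeasurable, lintegral_sum_measure,
    tsum_eq_zero_add' ENNReal.summable, ← ENNReal.tsum_mul_left]
  congr 1
  · simp [stepIter]
  · refine tsum_congr fun t => ?_
    rw [lintegral_smul_measure, Measure.smul_apply, smul_eq_mul, smul_eq_mul, stepIter,
      Measure.bind_apply hB hK.aemeasurable, ← mul_assoc, ← ENNReal.ofReal_mul hγ0]
    congr 2
    ring

end
end

section
/- Assume sup_{s∈S} ∫ (π(a|s)/π_b(a|s))² π_b(da|s) ≤ χ₁ and sup_{s∈S} ∫ (π(a|s)/π_b(a|s))² ‖g(s,a)‖_q² π_b(da|s) ≤ χ₂ (where the integrals are over a ∈ A with respect to the behavioral policy's conditional law). Then for every t ≥ 0 and every 0 ≤ l ≤ t, E_{τ∼ζ_μ^{π_b,p}}[ ρ_{π/π_b}(τ_{0:t})² · ‖g(s_l,a_l)‖_q² ] ≤ χ₂ · χ₁^t. -/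
open MeasureTheory ProbabilityTheory
open scoped ENNReal

noncomputable section

variable {S A : Type*} [MeasurableSpace S] [MeasurableSpace A]

/-- The law of the length-`(n+1)` prefix of the Markov chain on `X` with initial
distribution `m₀` and transition kernel `K` (the finite-dimensional distributions of the
Ionescu–Tulcea trajectory measure). -/
def prefixLaw {X : Type*} [MeasurableSpace X] (K : Kernel X X) (m₀ : Measure X) :
    (n : ℕ) → Measure (Fin (n + 1) → X)
  | 0 => m₀.map (fun x _ => x)
  | n + 1 =>
      ((prefixLaw K m₀ n) ⊗ₘ (K.comap (fun v => v (Fin.last n)) (measurable_pi_apply _))).map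
        (fun va => Fin.snoc va.1 va.2)

/-- `ζ` is the trajectory law (Ionescu–Tulcea) of the Markov chain with initial
distribution `m₀` and transition kernel `K`: its finite-dimensional prefix marginals are
given by `prefixLaw`. -/
def IsTrajLaw {X : Type*} [MeasurableSpace X] (K : Kernel X X) (m₀ : Measure X)
    (ζ : Measure (ℕ → X)) : Prop :=
  IsProbabilityMeasure ζ ∧
    ∀ n, ζ.map (fun τ => (fun i : Fin (n + 1) => τ i)) = prefixLaw K m₀ n
theorem measurable_lqNorm (q : ℝ≥0∞) [Fact (1 ≤ q)] {d : ℕ} :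
    Measurable (lqNorm q : (Fin d → ℝ) → ℝ) :=
  ((PiLp.continuous_toLp q (fun _ : Fin d => ℝ)).norm).measurable

instance prefixLaw.instSFinite {X : Type*} [MeasurableSpace X] (K : Kernel X X) [IsSFiniteKernel K]
    (m₀ : Measure X) [SFinite m₀] (n : ℕ) : SFinite (prefixLaw K m₀ n) := by
  cases n <;> (unfold prefixLaw; infer_instance)

/-- The expectation of a product of nonnegative functions of the successive states of a Markov
chain is at most the product of uniform bounds on their one-step conditional expectations. -/
theorem lintegral_prod_prefixLaw_le {X : Type*} [MeasurableSpace X] (K : Kernel X X)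
    [IsSFiniteKernel K] (m₀ : Measure X) [SFinite m₀] (w : ℕ → X → ℝ≥0∞)
    (hw : ∀ k, Measurable (w k)) (c : ℕ → ℝ≥0∞) (h₀ : ∫⁻ x, w 0 x ∂m₀ ≤ c 0)
    (hK : ∀ k x, ∫⁻ y, w k y ∂(K x) ≤ c k) (n : ℕ) :
    ∫⁻ v, ∏ i : Fin (n + 1), w i (v i) ∂(prefixLaw K m₀ n) ≤ ∏ k ∈ Finset.range (n + 1), c k := by
  induction n with
  | zero =>
    refine (lintegral_map_le _ _).trans ?_
    simpa using h₀
  | succ n ih =>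
    refine (lintegral_map_le _ _).trans ?_
    simp only [Fin.prod_univ_castSucc (n := n + 1), Fin.snoc_castSucc, Fin.snoc_last,
      Fin.val_castSucc, Fin.val_last]
    have hprod : Measurable fun v : Fin (n + 1) → X => ∏ i : Fin (n + 1), w i (v i) := by
      fun_prop
    rw [Measure.lintegral_compProd (by fun_prop)]
    calc
      _ ≤ ∫⁻ v, (∏ i : Fin (n + 1), w i (v i)) * c (n + 1) ∂(prefixLaw K m₀ n) := by
        refine lintegral_mono fun v => ?_
        dsimp only
        rw [lintegral_const_mul _ (hw _)]
        exact mul_le_mul_right (hK _ _) _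
      _ ≤ _ := by
        rw [lintegral_mul_const _ hprod, Finset.prod_range_succ _ (n + 1)]
        exact mul_le_mul_left ih _

theorem lintegral_stepK_le (p : Kernel (S × A) S) [IsMarkovKernel p] (π : Kernel S A)
    [IsSFiniteKernel π] {w : S × A → ℝ≥0∞} (hw : Measurable w) {c : ℝ≥0∞}
    (hc : ∀ s, ∫⁻ a, w (s, a) ∂(π s) ≤ c) (x : S × A) : ∫⁻ y, w y ∂(stepK p π x) ≤ c := by
  rw [stepK, Kernel.lintegral_compProd _ _ _ hw]
  simpa using lintegral_mono (μ := p x) hc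

theorem lintegral_compProd_le_of_forall_le (μ : Measure S) [IsProbabilityMeasure μ]
    (π : Kernel S A) [IsSFiniteKernel π] {w : S × A → ℝ≥0∞} (hw : Measurable w) {c : ℝ≥0∞}
    (hc : ∀ s, ∫⁻ a, w (s, a) ∂(π s) ≤ c) : ∫⁻ y, w y ∂(μ ⊗ₘ π) ≤ c := by
  rw [Measure.lintegral_compProd hw]
  simpa using lintegral_mono (μ := μ) hc

/-- Second-moment bound on importance weights times score norms: under the bounds `χ₁` and
`χ₂` on the conditional second moments, for every `t` and `l ≤ t`,
`E_{τ∼ζ_μ^{π_b,p}}[ρ_{π/π_b}(τ_{0:t})² ‖g(s_l,a_l)‖_q²] ≤ χ₂ χ₁^t`. -/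
theorem is_weight_score_second_moment
    (p : Kernel (S × A) S) [IsMarkovKernel p]
    (π πb : Kernel S A) [IsMarkovKernel π] [IsMarkovKernel πb]
    (μ : Measure S) [IsProbabilityMeasure μ]
    -- densities of π and π_b w.r.t. a common σ-finite reference measure on A
    (lamA : Measure A) [SigmaFinite lamA]
    (fπ fπb : S → A → ℝ)
    (hfπ : Measurable (Function.uncurry fπ)) (hfπb : Measurable (Function.uncurry fπb))
    (hfπb_pos : ∀ s a, 0 < fπb s a)
    (hπd : ∀ s, π s = lamA.withDensity (fun a => ENNReal.ofReal (fπ s a)))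
    (hπbd : ∀ s, πb s = lamA.withDensity (fun a => ENNReal.ofReal (fπb s a)))
    (d : ℕ) (hd : 1 ≤ d) (q : ℝ≥0∞) [Fact (1 ≤ q)]
    (g : S × A → Fin d → ℝ) (hg : Measurable g)
    (χ₁ χ₂ : ℝ)
    (hχ₁ : ∀ s, ∫⁻ a, ENNReal.ofReal ((fπ s a / fπb s a) ^ 2) ∂(πb s) ≤
      ENNReal.ofReal χ₁)
    (hχ₂ : ∀ s, ∫⁻ a,
        ENNReal.ofReal ((fπ s a / fπb s a) ^ 2 * (lqNorm q (g (s, a))) ^ 2) ∂(πb s) ≤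
      ENNReal.ofReal χ₂)
    (ζb : Measure (ℕ → S × A)) (hζb : IsTrajLaw (stepK p πb) (μ ⊗ₘ πb) ζb)
    (t l : ℕ) (hl : l ≤ t) :
    ∫⁻ τ, ENNReal.ofReal
        ((∏ k ∈ Finset.range (t + 1), fπ (τ k).1 (τ k).2 / fπb (τ k).1 (τ k).2) ^ 2 *
          (lqNorm q (g (τ l))) ^ 2) ∂ζb ≤
      ENNReal.ofReal χ₂ * ENNReal.ofReal χ₁ ^ t := by
  set r : S × A → ℝ := fun x => fπ x.1 x.2 / fπb x.1 x.2
  have hrm : Measurable r := hfπ.div hfπb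
  set w : ℕ → S × A → ℝ≥0∞ := fun k x =>
    if k = l then ENNReal.ofReal (r x ^ 2 * lqNorm q (g x) ^ 2) else ENNReal.ofReal (r x ^ 2)
    with hw_def
  set c : ℕ → ℝ≥0∞ := fun k => if k = l then ENNReal.ofReal χ₂ else ENNReal.ofReal χ₁ with hc_def
  have hw : ∀ k, Measurable (w k) := by
    intro k
    have hgm : Measurable fun x => lqNorm q (g x) := (measurable_lqNorm q).comp hg
    by_cases hk : k = l
    · simp only [hw_def, hk, if_true]
      fun_prop
    · simp only [hw_def, hk, if_false]
      fun_prop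
  have hwc : ∀ k s, ∫⁻ a, w k (s, a) ∂(πb s) ≤ c k := by
    intro k s
    by_cases hk : k = l
    · simpa only [hw_def, hc_def, hk, if_true] using hχ₂ s
    · simpa only [hw_def, hc_def, hk, if_false] using hχ₁ s
  have hmem : l ∈ Finset.range (t + 1) := Finset.mem_range.2 (Nat.lt_succ_of_le hl)
  have hfactor : ∀ τ : ℕ → S × A,
      ENNReal.ofReal ((∏ k ∈ Finset.range (t + 1), r (τ k)) ^ 2 * lqNorm q (g (τ l)) ^ 2) =
        ∏ i : Fin (t + 1), w i (τ i) := by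
    intro τ
    rw [← Finset.prod_range fun k => w k (τ k), ← Finset.mul_prod_erase _ _ hmem,
      ← Finset.mul_prod_erase _ _ hmem, mul_pow, mul_right_comm,
      ENNReal.ofReal_mul (by positivity), ← Finset.prod_pow,
      ENNReal.ofReal_prod_of_nonneg fun _ _ => sq_nonneg _]
    congr 1
    · simp [hw_def]
    · exact Finset.prod_congr rfl fun k hk => by simp [hw_def, Finset.ne_of_mem_erase hk]
  have hc : ∏ k ∈ Finset.range (t + 1), c k = ENNReal.ofReal χ₂ * ENNReal.ofReal χ₁ ^ t := by
    rw [← Finset.mul_prod_erase _ _ hmem,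
      Finset.prod_congr rfl fun k hk => if_neg (Finset.ne_of_mem_erase hk)]
    simp [hc_def, Finset.card_erase_of_mem hmem]
  have : IsSFiniteKernel (stepK p πb) := by unfold stepK; infer_instance
  calc
    _ = ∫⁻ τ, ∏ i : Fin (t + 1), w i (τ i) ∂ζb := lintegral_congr hfactor
    _ = ∫⁻ v, ∏ i : Fin (t + 1), w i (v i) ∂(prefixLaw (stepK p πb) (μ ⊗ₘ πb) t) := by
      rw [← hζb.2 t, lintegral_map (by fun_prop) (by fun_prop)]
    _ ≤ ∏ k ∈ Finset.range (t + 1), c k :=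
      lintegral_prod_prefixLaw_le _ _ w hw c
        (lintegral_compProd_le_of_forall_le μ πb (hw 0) (hwc 0))
        (fun k => lintegral_stepK_le p πb (hw k) (hwc k)) t
    _ = _ := hc

end
end

section
/- Assume sup_{s∈S} ∫ (π(a|s)/π_b(a|s))² π_b(da|s) ≤ χ₁ with γ·χ₁ < 1 and sup_{s∈S} ∫ (π(a|s)/π_b(a|s))² ‖g(s,a)‖_q² π_b(da|s) ≤ χ₂. Let V : S × A → ℝ be measurable with |V(s,a)| ≤ R_max/(1−γ) pointwise, and let g_j denote the j-th coordinate of g for some j ∈ {1,…,d}. Then E_{τ∼ζ_μ^{π_b,p}}[ ( Σ_{t≥0} γ^t ρ_{π/π_b}(τ_{0:t}) · g_j(s_t,a_t) · V(s_t,a_t) )² ] ≤ R_max²·χ₂ / ( (1−γ)³·(1−γχ₁) ). -/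
open MeasureTheory ProbabilityTheory
open scoped ENNReal

noncomputable section

variable {S A : Type*} [MeasurableSpace S] [MeasurableSpace A]

theorem ENNReal.ofReal_sq_eq_enorm_sq (x : ℝ) : ENNReal.ofReal (x ^ 2) = ‖x‖ₑ ^ 2 := by
  rw [Real.enorm_eq_ofReal_abs, ← ENNReal.ofReal_pow (abs_nonneg x), sq_abs]

theorem Real.enorm_finsetProd {ι : Type*} (s : Finset ι) (f : ι → ℝ) :
    ‖∏ i ∈ s, f i‖ₑ = ∏ i ∈ s, ‖f i‖ₑ := by
  simp [enorm_eq_nnnorm]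

/-- Weighted Cauchy–Schwarz inequality for series in `ℝ≥0∞`. -/
theorem ENNReal.sq_tsum_mul_le {ι : Type*} (w f : ι → ℝ≥0∞) :
    (∑' i, w i * f i) ^ 2 ≤ (∑' i, w i) * ∑' i, w i * f i ^ 2 := by
  have hfin (s : Finset ι) :
      (∑ i ∈ s, w i * f i) ^ 2 ≤ (∑' i, w i) * ∑' i, w i * f i ^ 2 := by
    have h := ENNReal.inner_le_weight_mul_Lp_of_nonneg s one_le_two w f
    have h2 : (∑ i ∈ s, w i * f i) ^ 2 ≤ (∑ i ∈ s, w i) * ∑ i ∈ s, w i * f i ^ 2 := by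
      calc (∑ i ∈ s, w i * f i) ^ 2
          ≤ ((∑ i ∈ s, w i) ^ (1 - (2 : ℝ)⁻¹) * (∑ i ∈ s, w i * f i ^ (2 : ℝ)) ^ (2 : ℝ)⁻¹) ^ 2 := by
            gcongr
        _ = (∑ i ∈ s, w i) * ∑ i ∈ s, w i * f i ^ 2 := by
            rw [mul_pow, ← ENNReal.rpow_mul_natCast, ← ENNReal.rpow_mul_natCast]
            norm_num
    exact h2.trans (mul_le_mul' (ENNReal.sum_le_tsum s) (ENNReal.sum_le_tsum s))
  have hlim : Filter.Tendsto (fun s : Finset ι => (∑ i ∈ s, w i * f i) ^ 2) Filter.atTop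
      (nhds ((∑' i, w i * f i) ^ 2)) :=
    ((ENNReal.continuous_pow 2).tendsto _).comp ENNReal.summable.hasSum
  exact le_of_tendsto' hlim hfin

theorem measurable_finSnoc {X : Type*} [MeasurableSpace X] (n : ℕ) :
    Measurable (fun va : (Fin n → X) × X => (Fin.snoc va.1 va.2 : Fin (n + 1) → X)) := by
  refine measurable_pi_iff.2 fun i => ?_
  induction i using Fin.lastCases with
  | last => simpa using measurable_snd
  | cast i => simpa using measurable_fst.eval

theorem isProbabilityMeasure_prefixLaw {X : Type*} [MeasurableSpace X] (K : Kernel X X)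
    [IsMarkovKernel K] (m₀ : Measure X) [IsProbabilityMeasure m₀] (n : ℕ) :
    IsProbabilityMeasure (prefixLaw K m₀ n) := by
  induction n with
  | zero =>
    exact Measure.isProbabilityMeasure_map
      (by fun_prop : Measurable fun (x : X) (_ : Fin 1) => x).aemeasurable
  | succ n ih =>
    exact Measure.isProbabilityMeasure_map (measurable_finSnoc (n + 1)).aemeasurable

theorem lintegral_prefixLaw_succ {X : Type*} [MeasurableSpace X] (K : Kernel X X)
    [IsMarkovKernel K] (m₀ : Measure X) [IsProbabilityMeasure m₀] (n : ℕ)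
    {F : (Fin (n + 2) → X) → ℝ≥0∞} (hF : Measurable F) :
    ∫⁻ v, F v ∂prefixLaw K m₀ (n + 1) =
      ∫⁻ v, ∫⁻ x, F (Fin.snoc v x) ∂K (v (Fin.last n)) ∂prefixLaw K m₀ n := by
  have := isProbabilityMeasure_prefixLaw K m₀ n
  rw [prefixLaw, lintegral_map hF (measurable_finSnoc (n + 1)),
    Measure.lintegral_compProd (by exact hF.comp (measurable_finSnoc (n + 1)))]
  rfl

/-- If a weight has one-step mass at most `B` and weighted one-step integral of `h` at most `H`,
then the weight of a prefix of length `n + 1` multiplied by `h` at the last state has integral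
at most `B ^ n * H`. -/
theorem lintegral_prefixLaw_prod_mul_le {X : Type*} [MeasurableSpace X] (K : Kernel X X)
    [IsMarkovKernel K] (m₀ : Measure X) [IsProbabilityMeasure m₀]
    {w : X → ℝ≥0∞} (hw : Measurable w) {B : ℝ≥0∞}
    (hB₀ : ∫⁻ x, w x ∂m₀ ≤ B) (hB : ∀ y, ∫⁻ x, w x ∂K y ≤ B)
    (n : ℕ) {h : X → ℝ≥0∞} (hh : Measurable h) {H : ℝ≥0∞}
    (hH₀ : ∫⁻ x, w x * h x ∂m₀ ≤ H) (hH : ∀ y, ∫⁻ x, w x * h x ∂K y ≤ H) :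
    ∫⁻ v, (∏ i, w (v i)) * h (v (Fin.last n)) ∂prefixLaw K m₀ n ≤ B ^ n * H := by
  induction n generalizing h H with
  | zero =>
    rw [prefixLaw, lintegral_map (by fun_prop) (by fun_prop)]
    simpa using hH₀
  | succ n ih =>
    rw [lintegral_prefixLaw_succ K m₀ n (by fun_prop)]
    calc _ = ∫⁻ v, (∏ i, w (v i)) * ∫⁻ x, w x * h x ∂K (v (Fin.last n)) ∂prefixLaw K m₀ n := by
          refine lintegral_congr fun v => ?_
          rw [← lintegral_const_mul _ (by fun_prop)]
          refine lintegral_congr fun x => ?_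
          rw [Fin.prod_univ_castSucc]
          simp [mul_assoc]
      _ ≤ ∫⁻ v, ((∏ i, w (v i)) * 1) * H ∂prefixLaw K m₀ n := by
          refine lintegral_mono fun v => ?_
          rw [mul_one]
          exact mul_le_mul_right (hH _) _
      _ ≤ B ^ n * B * H := by
          rw [lintegral_mul_const _ (by fun_prop)]
          exact mul_le_mul_left (ih measurable_const (by simpa using hB₀) (by simpa using hB)) _
      _ = B ^ (n + 1) * H := by rw [pow_succ]

theorem lintegral_trajLaw_prod_mul_le {X : Type*} [MeasurableSpace X] {K : Kernel X X}
    [IsMarkovKernel K] {m₀ : Measure X} [IsProbabilityMeasure m₀] {ζ : Measure (ℕ → X)}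
    (hζ : IsTrajLaw K m₀ ζ)
    {w : X → ℝ≥0∞} (hw : Measurable w) {B : ℝ≥0∞}
    (hB₀ : ∫⁻ x, w x ∂m₀ ≤ B) (hB : ∀ y, ∫⁻ x, w x ∂K y ≤ B)
    {h : X → ℝ≥0∞} (hh : Measurable h) {H : ℝ≥0∞}
    (hH₀ : ∫⁻ x, w x * h x ∂m₀ ≤ H) (hH : ∀ y, ∫⁻ x, w x * h x ∂K y ≤ H) (n : ℕ) :
    ∫⁻ τ, (∏ k ∈ Finset.range (n + 1), w (τ k)) * h (τ n) ∂ζ ≤ B ^ n * H := by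
  have key := lintegral_prefixLaw_prod_mul_le K m₀ hw hB₀ hB n hh hH₀ hH
  rw [← hζ.2 n, lintegral_map (by fun_prop) (by fun_prop)] at key
  simpa [Finset.prod_range] using key

theorem lintegral_compProd_le_of_forall {X Y : Type*} [MeasurableSpace X] [MeasurableSpace Y]
    (m : Measure X) [IsProbabilityMeasure m] (κ : Kernel X Y) [IsMarkovKernel κ]
    {f : X × Y → ℝ≥0∞} (hf : Measurable f) {c : ℝ≥0∞} (hc : ∀ x, ∫⁻ y, f (x, y) ∂κ x ≤ c) :
    ∫⁻ z, f z ∂(m ⊗ₘ κ) ≤ c := by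
  rw [Measure.lintegral_compProd hf]
  exact (lintegral_mono hc).trans (by simp)

instance isMarkovKernel_stepK (p : Kernel (S × A) S) [IsMarkovKernel p] (π : Kernel S A)
    [IsMarkovKernel π] : IsMarkovKernel (stepK p π) := by
  unfold stepK
  infer_instance

theorem lintegral_stepK_le_of_forall (p : Kernel (S × A) S) [IsMarkovKernel p] (π : Kernel S A)
    [IsMarkovKernel π] {f : S × A → ℝ≥0∞} (hf : Measurable f) {c : ℝ≥0∞}
    (hc : ∀ s, ∫⁻ a, f (s, a) ∂π s ≤ c) (y : S × A) :
    ∫⁻ z, f z ∂stepK p π y ≤ c := by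
  rw [stepK, Kernel.lintegral_compProd _ _ _ hf]
  simp only [Kernel.prodMkLeft_apply]
  exact (lintegral_mono hc).trans (by simp)

/-- The second moment of the density ratio of two probability measures is positive. -/
theorem lintegral_sq_div_withDensity_ne_zero {l : Measure A} {f fb : A → ℝ}
    (hf : Measurable f) (hfb : Measurable fb) (hpos : ∀ a, 0 < fb a)
    (hl : l.withDensity (fun a => ENNReal.ofReal (f a)) ≠ 0) :
    ∫⁻ a, ENNReal.ofReal ((f a / fb a) ^ 2) ∂l.withDensity (fun a => ENNReal.ofReal (fb a)) ≠ 0 := by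
  contrapose! hl
  rw [lintegral_withDensity_eq_lintegral_mul _ (by fun_prop) (by fun_prop),
    lintegral_eq_zero_iff (by fun_prop)] at hl
  refine withDensity_eq_zero_iff (by fun_prop) |>.2 ?_
  filter_upwards [hl] with a ha
  have hfa : f a = 0 := by
    by_contra hne
    have h1 : 0 < (f a / fb a) ^ 2 := by
      have := (hpos a).ne'
      positivity
    have h2 : 0 < ENNReal.ofReal (fb a) * ENNReal.ofReal ((f a / fb a) ^ 2) :=
      ENNReal.mul_pos (ENNReal.ofReal_pos.2 (hpos a)).ne' (ENNReal.ofReal_pos.2 h1).ne'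
    exact h2.ne' ha
  simp [hfa]

theorem ENNReal.tsum_ofReal_geometric {r : ℝ} (h0 : 0 ≤ r) (h1 : r < 1) :
    ∑' t : ℕ, ENNReal.ofReal (r ^ t) = ENNReal.ofReal (1 - r)⁻¹ := by
  rw [← ENNReal.ofReal_tsum_of_nonneg (fun t => pow_nonneg h0 t)
    (summable_geometric_of_lt_one h0 h1), tsum_geometric_of_lt_one h0 h1]

theorem abs_apply_le_lqNorm (q : ℝ≥0∞) [Fact (1 ≤ q)] {d : ℕ} (v : Fin d → ℝ) (j : Fin d) :
    |v j| ≤ lqNorm q v := by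
  simpa [lqNorm] using PiLp.norm_apply_le ((WithLp.equiv q (Fin d → ℝ)).symm v) j

/-- Pointwise Cauchy–Schwarz bound for a discounted series. -/
theorem enorm_sq_tsum_discount_le {γ : ℝ} (hγ0 : 0 ≤ γ) (hγ1 : γ < 1) (y : ℕ → ℝ) :
    ‖∑' t, γ ^ t * y t‖ₑ ^ 2 ≤
      ENNReal.ofReal (1 - γ)⁻¹ * ∑' t, ENNReal.ofReal (γ ^ t) * ‖y t‖ₑ ^ 2 := by
  rw [← ENNReal.tsum_ofReal_geometric hγ0 hγ1]
  refine le_trans ?_ (ENNReal.sq_tsum_mul_le _ _)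
  gcongr
  refine enorm_tsum_le_tsum_enorm.trans_eq (tsum_congr fun t => ?_)
  rw [enorm_mul, Real.enorm_of_nonneg (pow_nonneg hγ0 t)]

/-- Second-moment bound for the gradient estimator terms: under the conditional moment
bounds `χ₁`, `χ₂` (with `γ χ₁ < 1`), for any measurable `V` with `|V| ≤ R_max/(1−γ)` and
any coordinate `j`,
`E_{τ∼ζ_μ^{π_b,p}}[(∑ₜ γ^t ρ_{π/π_b}(τ_{0:t}) g_j(s_t,a_t) V(s_t,a_t))²]
  ≤ R_max² χ₂ / ((1−γ)³ (1−γχ₁))`. -/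
theorem gradient_estimator_second_moment
    (p : Kernel (S × A) S) [IsMarkovKernel p]
    (π πb : Kernel S A) [IsMarkovKernel π] [IsMarkovKernel πb]
    (μ : Measure S) [IsProbabilityMeasure μ]
    (γ : ℝ) (hγ0 : 0 ≤ γ) (hγ1 : γ < 1)
    (Rmax : ℝ) (hRmax : 0 < Rmax)
    -- densities of π and π_b w.r.t. a common σ-finite reference measure on A
    (lamA : Measure A) [SigmaFinite lamA]
    (fπ fπb : S → A → ℝ)
    (hfπ : Measurable (Function.uncurry fπ)) (hfπb : Measurable (Function.uncurry fπb))
    (hfπb_pos : ∀ s a, 0 < fπb s a)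
    (hπd : ∀ s, π s = lamA.withDensity (fun a => ENNReal.ofReal (fπ s a)))
    (hπbd : ∀ s, πb s = lamA.withDensity (fun a => ENNReal.ofReal (fπb s a)))
    (d : ℕ) (hd : 1 ≤ d) (q : ℝ≥0∞) [Fact (1 ≤ q)]
    (g : S × A → Fin d → ℝ) (hg : Measurable g)
    (χ₁ χ₂ : ℝ) (hγχ₁ : γ * χ₁ < 1)
    (hχ₁ : ∀ s, ∫⁻ a, ENNReal.ofReal ((fπ s a / fπb s a) ^ 2) ∂(πb s) ≤
      ENNReal.ofReal χ₁)
    (hχ₂ : ∀ s, ∫⁻ a,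
        ENNReal.ofReal ((fπ s a / fπb s a) ^ 2 * (lqNorm q (g (s, a))) ^ 2) ∂(πb s) ≤
      ENNReal.ofReal χ₂)
    (V : S × A → ℝ) (hV : Measurable V) (hVb : ∀ x, |V x| ≤ Rmax / (1 - γ))
    (j : Fin d)
    (ζb : Measure (ℕ → S × A)) (hζb : IsTrajLaw (stepK p πb) (μ ⊗ₘ πb) ζb) :
    ∫⁻ τ, ENNReal.ofReal
        ((∑' t : ℕ, γ ^ t *
            (∏ k ∈ Finset.range (t + 1), fπ (τ k).1 (τ k).2 / fπb (τ k).1 (τ k).2) *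
            g (τ t) j * V (τ t)) ^ 2) ∂ζb ≤
      ENNReal.ofReal (Rmax ^ 2 * χ₂ / ((1 - γ) ^ 3 * (1 - γ * χ₁))) := by
  obtain ⟨s₀⟩ := nonempty_of_isProbabilityMeasure μ
  have hχ₁0 : 0 ≤ χ₁ := by
    by_contra hneg
    refine lintegral_sq_div_withDensity_ne_zero (l := lamA) (hfπ.of_uncurry_left (x := s₀))
      (hfπb.of_uncurry_left (x := s₀)) (hfπb_pos s₀) (hπd s₀ ▸ IsProbabilityMeasure.ne_zero _) ?_
    rw [← hπbd s₀]
    simpa [ENNReal.ofReal_of_nonpos (not_le.1 hneg).le] using hχ₁ s₀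
  have h1γ : 0 < 1 - γ := sub_pos.2 hγ1
  have h1γχ : 0 < 1 - γ * χ₁ := sub_pos.2 hγχ₁
  set r : S × A → ℝ := fun x => fπ x.1 x.2 / fπb x.1 x.2 with hr
  have hrm : Measurable r := hfπ.div hfπb
  have hgm : Measurable fun x => g x j := (measurable_pi_apply j).comp hg
  set w : S × A → ℝ≥0∞ := fun x => ‖r x‖ₑ ^ 2 with hw
  set h : S × A → ℝ≥0∞ := fun x => ‖g x j‖ₑ ^ 2 with hh
  have hwm : Measurable w := by fun_prop
  have hhm : Measurable h := by fun_prop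
  have hB (s : S) : ∫⁻ a, w (s, a) ∂πb s ≤ ENNReal.ofReal χ₁ := by
    simpa [hw, hr, ENNReal.ofReal_sq_eq_enorm_sq] using hχ₁ s
  have hH (s : S) : ∫⁻ a, w (s, a) * h (s, a) ∂πb s ≤ ENNReal.ofReal χ₂ := by
    refine (lintegral_mono fun a => ?_).trans (hχ₂ s)
    simp only [hw, hh, hr, ← ENNReal.ofReal_sq_eq_enorm_sq, ← ENNReal.ofReal_mul (sq_nonneg _)]
    refine ENNReal.ofReal_le_ofReal (mul_le_mul_of_nonneg_left ?_ (sq_nonneg _))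
    rw [← sq_abs]
    gcongr
    exact abs_apply_le_lqNorm q (g (s, a)) j
  have hmom (t : ℕ) : ∫⁻ τ, (∏ k ∈ Finset.range (t + 1), w (τ k)) * h (τ t) ∂ζb ≤
      ENNReal.ofReal χ₁ ^ t * ENNReal.ofReal χ₂ :=
    lintegral_trajLaw_prod_mul_le hζb hwm (lintegral_compProd_le_of_forall μ πb hwm hB)
      (lintegral_stepK_le_of_forall p πb hwm hB) hhm
      (lintegral_compProd_le_of_forall μ πb (hwm.mul hhm) hH)
      (lintegral_stepK_le_of_forall p πb (hwm.mul hhm) hH) t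
  set C : ℝ≥0∞ := ENNReal.ofReal ((Rmax / (1 - γ)) ^ 2) with hC
  have hVC (x : S × A) : ‖V x‖ₑ ^ 2 ≤ C := by
    rw [← ENNReal.ofReal_sq_eq_enorm_sq, ← sq_abs]
    exact ENNReal.ofReal_le_ofReal (pow_le_pow_left₀ (abs_nonneg _) (hVb x) 2)
  have hpt (τ : ℕ → S × A) :
      ENNReal.ofReal ((∑' t : ℕ, γ ^ t * (∏ k ∈ Finset.range (t + 1), r (τ k)) *
        g (τ t) j * V (τ t)) ^ 2) ≤
      ENNReal.ofReal (1 - γ)⁻¹ * ∑' t, ENNReal.ofReal (γ ^ t) *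
        (((∏ k ∈ Finset.range (t + 1), w (τ k)) * h (τ t)) * C) := by
    simp only [ENNReal.ofReal_sq_eq_enorm_sq, mul_assoc (γ ^ _)]
    refine (enorm_sq_tsum_discount_le hγ0 hγ1 _).trans ?_
    gcongr with t
    rw [enorm_mul, enorm_mul, mul_pow, mul_pow, Real.enorm_finsetProd, ← Finset.prod_pow]
    exact mul_le_mul_right (hVC _) _
  calc _ ≤ ∫⁻ τ, ENNReal.ofReal (1 - γ)⁻¹ * ∑' t, ENNReal.ofReal (γ ^ t) *
        (((∏ k ∈ Finset.range (t + 1), w (τ k)) * h (τ t)) * C) ∂ζb := lintegral_mono hpt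
    _ = ENNReal.ofReal (1 - γ)⁻¹ * ∑' t, ENNReal.ofReal (γ ^ t) *
        ((∫⁻ τ, (∏ k ∈ Finset.range (t + 1), w (τ k)) * h (τ t) ∂ζb) * C) := by
      rw [lintegral_const_mul _ (by fun_prop), lintegral_tsum fun t => by fun_prop]
      congr! with t
      rw [lintegral_const_mul _ (by fun_prop), lintegral_mul_const _ (by fun_prop)]
    _ ≤ ENNReal.ofReal (1 - γ)⁻¹ * ∑' t, ENNReal.ofReal (γ ^ t) *
        ((ENNReal.ofReal χ₁ ^ t * ENNReal.ofReal χ₂) * C) := by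
      gcongr with t
      exact hmom t
    _ = ENNReal.ofReal (1 - γ)⁻¹ * ((∑' t, ENNReal.ofReal ((γ * χ₁) ^ t)) *
        (ENNReal.ofReal χ₂ * C)) := by
      rw [← ENNReal.tsum_mul_right]
      congr! 3 with t
      rw [mul_pow, ENNReal.ofReal_mul (pow_nonneg hγ0 t), ENNReal.ofReal_pow hχ₁0]
      ring
    _ = ENNReal.ofReal (Rmax ^ 2 * χ₂ / ((1 - γ) ^ 3 * (1 - γ * χ₁))) := by
      rw [ENNReal.tsum_ofReal_geometric (mul_nonneg hγ0 hχ₁0) hγχ₁, hC,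
        ← ENNReal.ofReal_mul' (sq_nonneg _), ← ENNReal.ofReal_mul (inv_nonneg.2 h1γχ.le),
        ← ENNReal.ofReal_mul (inv_nonneg.2 h1γ.le)]
      congr 1
      field_simp

end
end
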